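/- arXiv:2007.14082 — 2 statements merged into one kernel-verified Lean document; each statement's English description precedes it below -/
import Mathlib

section
/- Let K ⊂ ℝ be compact, M > 0, and f₊ an M-transfer function. Then for every continuous function f : K → (0, ∞) there exists a continuous function g : K → ℝ such that f(x) = f₊(g(x)) for all x ∈ K. -/
/-- A continuous function that attains every positive value and is strictly increasing where it is
positive has a right inverse on `(0, ∞)` that is continuous there. -/
theorem exists_continuousOn_rightInvOn_of_strictMonoOn_pos {φ : ℝ → ℝ} (hφ : Continuous φ)
    (hrange : ∀ y, 0 < y → ∃ x, φ x = y) (hmono : StrictMonoOn φ {x | 0 < φ x}) :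
    ∃ h : ℝ → ℝ, ContinuousOn h (Set.Ioi 0) ∧ Set.RightInvOn h φ (Set.Ioi 0) := by
  choose! h hh using hrange
  have hmem : ∀ y, 0 < y → h y ∈ {x | 0 < φ x} := fun y hy =>
    hy.trans_eq (hh y hy).symm
  have hh_mono : StrictMonoOn h (Set.Ioi 0) := fun y hy z hz hyz => by
    rwa [← hmono.lt_iff_lt (hmem y hy) (hmem z hz), hh y hy, hh z hz]
  have himage : {x | 0 < φ x} ⊆ h '' Set.Ioi 0 := fun x hx =>
    ⟨φ x, hx, hmono.injOn (hmem _ hx) hx (hh _ hx)⟩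
  refine ⟨h, fun y hy => ?_, hh⟩
  have hnhds : {x | 0 < φ x} ∈ nhds (h y) :=
    (isOpen_lt continuous_const hφ).mem_nhds (hmem y hy)
  exact (hh_mono.continuousAt_of_image_mem_nhds (Ioi_mem_nhds hy)
    (Filter.mem_of_superset hnhds himage)).continuousWithinAt

/-- Every continuous strictly positive function on a compact
`K ⊂ ℝ` factors through an `M`-transfer function: `f = fp ∘ g` for some
continuous `g : K → ℝ`. -/
theorem transfer_factorization
    (K : Set ℝ) (hK : IsCompact K) (M : ℝ) (hM : 0 < M)
    (fp : ℝ → ℝ)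
    (hfp_nonneg : ∀ x : ℝ, 0 ≤ fp x)
    (hfp_lip : ∀ x y : ℝ, |fp x - fp y| ≤ M * |x - y|)
    (hfp_range : ∀ y : ℝ, 0 < y → ∃ x : ℝ, fp x = y)
    (hfp_mono : StrictMonoOn fp {x : ℝ | 0 < fp x})
    (f : ℝ → ℝ) (hf_cont : ContinuousOn f K) (hf_pos : ∀ x ∈ K, 0 < f x) :
    ∃ g : ℝ → ℝ, ContinuousOn g K ∧ ∀ x ∈ K, f x = fp (g x) := by
  have hfp_cont : Continuous fp :=
    (LipschitzWith.of_dist_le_mul (K := ⟨M, hM.le⟩) hfp_lip).continuous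
  obtain ⟨h, h_cont, h_inv⟩ :=
    exists_continuousOn_rightInvOn_of_strictMonoOn_pos hfp_cont hfp_range hfp_mono
  exact ⟨h ∘ f, h_cont.comp hf_cont hf_pos, fun x hx => (h_inv (hf_pos x hx)).symm⟩
end

section
/- Let I, J, n, N be positive integers, let K ⊂ ℝ^I be compact, let S ⊂ ℝ^J be compact, let g : ℝ^J × ℝ^I → ℝ^J be continuous with g(S × K) ⊆ S, and let ν : ℝ^J → ℝ^n be continuous. Fix an initial state s₁ ∈ S and consider the open dynamic system s_{i+1} = g(s_i, x_i), p_i = ν(s_i) for i = 1, …, N. Then for every ε > 0 there exist a dimension d, matrices W ∈ ℝ^{d×d}, V ∈ ℝ^{d×I}, A ∈ ℝ^{n×d}, and vectors b, h₀ ∈ ℝ^d such that for every input sequence x₁, …, x_N ∈ K, defining h_i = σ(W h_{i−1} + V x_i + b) with the sigmoid σ applied componentwise, one has ‖ν(s_i) − A h_i‖ < ε for all i = 1, …, N. -/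
/-- The sigmoid function `σ(x) = 1 / (1 + exp (−x))`. -/
noncomputable def sigmoid (x : ℝ) : ℝ := 1 / (1 + Real.exp (-x))

open Filter Topology Metric

lemma continuous_sigmoid_fun : Continuous sigmoid := by
  unfold sigmoid
  exact continuous_const.div (by fun_prop) fun x => by positivity

lemma sigmoid_zero_eq : sigmoid 0 = 1 / 2 := by
  norm_num [sigmoid]

/-- A rescaled, shifted sigmoid approximates the exponential function from below. -/
lemma abs_exp_sub_exp_mul_sigmoid_le (t L : ℝ) :
    |Real.exp t - Real.exp L * sigmoid (t - L)| ≤ Real.exp (2 * t) * Real.exp (-L) := by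
  have h : Real.exp t - Real.exp L * sigmoid (t - L)
      = Real.exp (2 * t) * Real.exp (-L) / (1 + Real.exp (t - L)) := by
    have ht := Real.exp_pos t
    have hL := Real.exp_pos L
    rw [sigmoid, neg_sub, Real.exp_sub, Real.exp_sub, two_mul, Real.exp_add, Real.exp_neg]
    field_simp
    ring
  rw [h, abs_of_nonneg (by positivity)]
  exact div_le_self (by positivity) (by linarith [Real.exp_pos (t - L)])

section UniversalApproximation

variable {E : Type*} [NormedAddCommGroup E] [NormedSpace ℝ E]

/-- The ridge function `x ↦ exp (ℓ x)` on a set, multiplicative in `ℓ`. -/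
noncomputable def expRidge (Q : Set E) : Multiplicative (E →L[ℝ] ℝ) →* C(Q, ℝ) where
  toFun ℓ := ⟨fun x => Real.exp (ℓ.toAdd x), by fun_prop⟩
  map_one' := by ext x; simp
  map_mul' ℓ ℓ' := by ext x; simp [Real.exp_add]

/-- The ridge function `x ↦ sigmoid (ℓ x + b)` on a set. -/
noncomputable def sigmoidRidge (Q : Set E) (u : (E →L[ℝ] ℝ) × ℝ) : C(Q, ℝ) :=
  ⟨fun x => sigmoid (u.1 x + u.2), continuous_sigmoid_fun.comp (by fun_prop)⟩

lemma expRidge_mem_closure_span_sigmoidRidge (Q : Set E) [CompactSpace Q]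
    (ℓ : Multiplicative (E →L[ℝ] ℝ)) :
    expRidge Q ℓ ∈ (Submodule.span ℝ (Set.range (sigmoidRidge Q))).topologicalClosure := by
  have hlim : Tendsto (fun L : ℝ => Real.exp L • sigmoidRidge Q (ℓ.toAdd, -L)) atTop
      (𝓝 (expRidge Q ℓ)) := by
    rw [tendsto_iff_norm_sub_tendsto_zero]
    have hbound : Tendsto (fun L : ℝ => ‖expRidge Q ℓ ^ 2‖ * Real.exp (-L)) atTop (𝓝 0) := by
      simpa using Real.tendsto_exp_neg_atTop_nhds_zero.const_mul ‖expRidge Q ℓ ^ 2‖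
    refine squeeze_zero (fun _ => norm_nonneg _) (fun L => ?_) hbound
    refine (ContinuousMap.norm_le _ (by positivity)).2 fun x => ?_
    have h := abs_exp_sub_exp_mul_sigmoid_le (ℓ.toAdd (x : E)) L
    rw [abs_sub_comm] at h
    refine h.trans (mul_le_mul_of_nonneg_right ?_ (Real.exp_pos _).le)
    have hx := (le_abs_self _).trans ((expRidge Q ℓ ^ 2).norm_coe_le_norm x)
    rw [two_mul, Real.exp_add, ← sq]
    exact hx
  refine mem_closure_of_tendsto hlim (Eventually.of_forall fun L => ?_)
  exact Submodule.smul_mem _ _ (Submodule.subset_span ⟨_, rfl⟩)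

lemma topologicalClosure_span_sigmoidRidge (Q : Set E) [CompactSpace Q] :
    (Submodule.span ℝ (Set.range (sigmoidRidge Q))).topologicalClosure = ⊤ := by
  have hsep : (Algebra.adjoin ℝ (Set.range (expRidge Q))).SeparatesPoints := by
    intro x y hxy
    obtain ⟨ℓ, hℓ⟩ := SeparatingDual.exists_separating_of_ne (R := ℝ)
      (fun h => hxy (Subtype.ext h) : (x : E) ≠ y)
    refine ⟨_, ⟨expRidge Q (.ofAdd ℓ), Algebra.subset_adjoin ⟨_, rfl⟩, rfl⟩, ?_⟩
    exact fun h => hℓ (Real.exp_injective h)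
  have hspan : Subalgebra.toSubmodule (Algebra.adjoin ℝ (Set.range (expRidge Q)))
      ≤ (Submodule.span ℝ (Set.range (sigmoidRidge Q))).topologicalClosure := by
    rw [Algebra.adjoin_eq_span, ← MonoidHom.coe_mrange, Submonoid.closure_eq,
      MonoidHom.coe_mrange, Submodule.span_le]
    rintro _ ⟨ℓ, rfl⟩
    exact expRidge_mem_closure_span_sigmoidRidge Q ℓ
  refine eq_top_iff.2 fun f _ => ?_
  have hf := ContinuousMap.continuousMap_mem_subalgebra_closure_of_separatesPoints _ hsep f
  exact closure_minimal hspan (Submodule.isClosed_topologicalClosure _) hf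

/-- Universal approximation by one hidden layer of sigmoid units on a compact set, for finitely
many functions sharing the same units. -/
theorem exists_sigmoid_network_near {κ : Type*} [Fintype κ] {Q : Set E} (hQ : IsCompact Q)
    {F : κ → E → ℝ} (hF : ∀ j, Continuous (F j)) {ε : ℝ} (hε : 0 < ε) :
    ∃ (d : ℕ) (ℓ : Fin d → E →L[ℝ] ℝ) (b : Fin d → ℝ) (c : κ → Fin d → ℝ),
      ∀ z ∈ Q, ∀ j, |F j z - ∑ k, c j k * sigmoid (ℓ k z + b k)| < ε := by
  classical
  have := isCompact_iff_compactSpace.1 hQ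
  have happrox : ∀ j, ∃ c : ((E →L[ℝ] ℝ) × ℝ) →₀ ℝ, ∀ z ∈ Q,
      |F j z - c.sum fun u r => r * sigmoid (u.1 z + u.2)| < ε := by
    intro j
    let f : C(Q, ℝ) := ⟨fun z => F j z, (hF j).comp continuous_subtype_val⟩
    have hf : f ∈ (Submodule.span ℝ (Set.range (sigmoidRidge Q))).topologicalClosure := by
      simp [topologicalClosure_span_sigmoidRidge]
    obtain ⟨p, hp, hfp⟩ := Metric.mem_closure_iff.1 hf ε hε
    obtain ⟨c, rfl⟩ := Finsupp.mem_span_range_iff_exists_finsupp.1 hp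
    refine ⟨c, fun z hz => ?_⟩
    have h := (ContinuousMap.dist_lt_iff hε).1 hfp ⟨z, hz⟩
    simpa [Real.dist_eq, f, Finsupp.sum, sigmoidRidge] using h
  choose c hc using happrox
  let T := Finset.univ.biUnion fun j => (c j).support
  refine ⟨T.card, fun k => (T.equivFin.symm k).1.1, fun k => (T.equivFin.symm k).1.2,
    fun j k => c j (T.equivFin.symm k).1, fun z hz j => ?_⟩
  convert hc j z hz using 3
  rw [Equiv.sum_comp T.equivFin.symm fun u : T => c j u.1 * sigmoid (u.1.1 z + u.1.2),
    Finset.sum_coe_sort T fun u => c j u * sigmoid (u.1 z + u.2)]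
  have hsub : (c j).support ⊆ T :=
    Finset.subset_biUnion_of_mem (fun j => (c j).support) (Finset.mem_univ j)
  exact (Finsupp.sum_of_support_subset (c j) hsub (fun u r => r * sigmoid (u.1 z + u.2))
    fun _ _ => zero_mul _).symm

end UniversalApproximation

/-- On a compact invariant set, trajectories of a perturbed system stay close to those of the
original one over finitely many steps. -/
lemma exists_perturbation_bound {X Y : Type*} [NormedAddCommGroup X] [ProperSpace X]
    [PseudoMetricSpace Y] {K : Set Y} (hK : IsCompact K) {S : Set X} (hS : IsCompact S)
    {g : X → Y → X} (hg : Continuous fun q : X × Y => g q.1 q.2) (N : ℕ) :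
    ∀ δ > 0, δ ≤ 1 → ∃ η > 0, ∀ (x : ℕ → Y) (s r : ℕ → X),
      (∀ i, 1 ≤ i → i ≤ N → x i ∈ K) → (∀ i, 1 ≤ i → i ≤ N → s i ∈ S) →
      (∀ i, 1 ≤ i → s (i + 1) = g (s i) (x i)) → r 1 = s 1 →
      (∀ i, 1 ≤ i → i ≤ N → r i ∈ cthickening 1 S → ‖r (i + 1) - g (r i) (x i)‖ < η) →
      ∀ i, 1 ≤ i → i ≤ N → ‖r i - s i‖ < δ := by
  induction N with
  | zero => exact fun δ _ _ => ⟨1, one_pos, fun _ _ _ _ _ _ _ _ i _ _ => by omega⟩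
  | succ N ih =>
    intro δ hδ hδ1
    have huc := ((hS.cthickening (r := 1)).prod hK).uniformContinuousOn_of_continuous
      hg.continuousOn
    obtain ⟨δ', hδ', hclose⟩ := Metric.uniformContinuousOn_iff.1 huc (δ / 2) (half_pos hδ)
    obtain ⟨η, hη, H⟩ := ih (min δ δ') (lt_min hδ hδ') ((min_le_left _ _).trans hδ1)
    refine ⟨min η (δ / 2), lt_min hη (half_pos hδ), fun x s r hx hs hstep hrs hr => ?_⟩
    have hprev := H x s r (fun i h1 h2 => hx i h1 (by omega)) (fun i h1 h2 => hs i h1 (by omega))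
      hstep hrs fun i h1 h2 h3 => (hr i h1 (by omega) h3).trans_le (min_le_left _ _)
    intro i h1 h2
    rcases Nat.lt_or_ge N i with hlt | hle
    · obtain rfl : i = N + 1 := by omega
      rcases Nat.eq_zero_or_pos N with rfl | hpos
      · simpa [hrs] using hδ
      · have hN := hprev N hpos le_rfl
        have hsN := hs N hpos (by omega)
        have hxN := hx N hpos (by omega)
        have hrN : r N ∈ cthickening 1 S := mem_cthickening_of_dist_le _ _ _ _ hsN
          (by rw [dist_eq_norm]; exact (hN.trans_le ((min_le_left _ _).trans hδ1)).le)
        have hpert := (hr N hpos (by omega) hrN).trans_le (min_le_right _ _)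
        have hgg := hclose (r N, x N) ⟨hrN, hxN⟩ (s N, x N)
          ⟨self_subset_cthickening S hsN, hxN⟩
          (by simpa [Prod.dist_eq, dist_eq_norm, hδ'] using hN.trans_le (min_le_right _ _))
        rw [dist_eq_norm] at hgg
        rw [hstep N hpos]
        linarith [norm_sub_le_norm_sub_add_norm_sub (r (N + 1)) (g (r N) (x N)) (g (s N) (x N))]
    · exact (hprev i h1 hle).trans_le (min_le_left _ _)

/-- One sigmoid layer approximating both the state update and the output map on a compact set, whose
state readout attains a prescribed initial state. -/
lemma exists_sigmoid_layer {I J n : ℕ} {Q : Set ((Fin J → ℝ) × (Fin I → ℝ))} (hQ : IsCompact Q)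
    {g : (Fin J → ℝ) → (Fin I → ℝ) → (Fin J → ℝ)}
    (hg : Continuous fun q : (Fin J → ℝ) × (Fin I → ℝ) => g q.1 q.2)
    {ν : (Fin J → ℝ) → (Fin n → ℝ)} (hν : Continuous ν) (s₁ : Fin J → ℝ)
    {η : ℝ} (hη : 0 < η) :
    ∃ (d : ℕ) (ℓ : Fin d → (Fin J → ℝ) × (Fin I → ℝ) →L[ℝ] ℝ) (b h₀ : Fin d → ℝ)
      (M : Matrix (Fin J) (Fin d) ℝ) (A : Matrix (Fin n) (Fin d) ℝ),
      M.mulVec h₀ = s₁ ∧ ∀ z ∈ Q,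
        ‖M.mulVec (fun k => sigmoid (ℓ k z + b k)) - g z.1 z.2‖ < η ∧
        ‖ν z.1 - A.mulVec (fun k => sigmoid (ℓ k z + b k))‖ < η := by
  let F : Fin J ⊕ Fin n → (Fin J → ℝ) × (Fin I → ℝ) → ℝ :=
    Sum.elim (fun j z => g z.1 z.2 j - s₁ j) (fun j z => ν z.1 j)
  have hF : ∀ j, Continuous (F j) := by
    rintro (j | j)
    · exact ((continuous_apply j).comp hg).sub continuous_const
    · exact (continuous_apply j).comp (hν.comp continuous_fst)
  obtain ⟨d, ℓ, b, c, hc⟩ := exists_sigmoid_network_near hQ hF hη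
  refine ⟨d + 1, Fin.cons 0 ℓ, Fin.cons 0 b, Fin.cons (1 / 2) 0,
    fun j => Fin.cons (2 * s₁ j) (c (.inl j)), fun j => Fin.cons 0 (c (.inr j)), ?_, ?_⟩
  · ext j
    simp [Matrix.mulVec, dotProduct, Fin.sum_univ_succ]
    ring
  · refine fun z hz => ⟨(pi_norm_lt_iff hη).2 fun j => ?_, (pi_norm_lt_iff hη).2 fun j => ?_⟩
    · have h := hc z hz (.inl j)
      rw [abs_sub_comm] at h
      rw [Real.norm_eq_abs]
      convert h using 2
      simp [Matrix.mulVec, dotProduct, Fin.sum_univ_succ, sigmoid_zero_eq, F]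
      ring
    · have h := hc z hz (.inr j)
      simpa [Matrix.mulVec, dotProduct, Fin.sum_univ_succ, F] using h

/-- (RNN universal approximation of open dynamic systems.)
Any open dynamic system `s_{i+1} = g(s_i, x_i)`, `p_i = ν(s_i)` with continuous
`g`, `ν`, compact invariant state space `S` and compact input space `K`, can be
approximated over `N` steps, uniformly over input sequences in `K`, by a
sigmoid RNN `h_i = σ(W h_{i−1} + V x_i + b)`, output `A h_i`. -/
theorem rnn_universal_approximation_dynamic_system
    (I J n N : ℕ) (hI : 0 < I) (hJ : 0 < J) (hn : 0 < n) (hN : 0 < N)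
    (K : Set (Fin I → ℝ)) (hK : IsCompact K)
    (S : Set (Fin J → ℝ)) (hS : IsCompact S)
    (g : (Fin J → ℝ) → (Fin I → ℝ) → (Fin J → ℝ))
    (hg_cont : Continuous fun q : (Fin J → ℝ) × (Fin I → ℝ) => g q.1 q.2)
    (hg_inv : ∀ s ∈ S, ∀ x ∈ K, g s x ∈ S)
    (ν : (Fin J → ℝ) → (Fin n → ℝ)) (hν : Continuous ν)
    (s₁ : Fin J → ℝ) (hs₁ : s₁ ∈ S)
    (ε : ℝ) (hε : 0 < ε) :
    ∃ (d : ℕ) (W : Matrix (Fin d) (Fin d) ℝ) (V : Matrix (Fin d) (Fin I) ℝ)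
      (A : Matrix (Fin n) (Fin d) ℝ) (b h₀ : Fin d → ℝ),
      ∀ x : ℕ → (Fin I → ℝ), (∀ i, 1 ≤ i → i ≤ N → x i ∈ K) →
        ∀ s : ℕ → (Fin J → ℝ),
          s 1 = s₁ → (∀ i, 1 ≤ i → s (i + 1) = g (s i) (x i)) →
          ∀ h : ℕ → (Fin d → ℝ),
            h 0 = h₀ →
            (∀ i, 1 ≤ i →
              h i = fun k =>
                sigmoid ((W.mulVec (h (i - 1)) + V.mulVec (x i) + b) k)) →
            ∀ i, 1 ≤ i → i ≤ N → ‖ν (s i) - A.mulVec (h i)‖ < ε := by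
  have hC : IsCompact (cthickening 1 S) := hS.cthickening
  obtain ⟨δ, hδ, hνδ⟩ := Metric.uniformContinuousOn_iff.1
    (hC.uniformContinuousOn_of_continuous hν.continuousOn) (ε / 2) (half_pos hε)
  obtain ⟨η, hη, hpert⟩ := exists_perturbation_bound hK hS hg_cont N (min δ 1)
    (lt_min hδ one_pos) (min_le_right _ _)
  obtain ⟨d, ℓ, b, h₀, M, A, hM, happrox⟩ := exists_sigmoid_layer (hC.prod hK) hg_cont hν s₁
    (lt_min hη (half_pos hε))
  let w : (Fin d → ℝ) →ₗ[ℝ] Fin d → ℝ :=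
    LinearMap.pi fun k => (ℓ k).toLinearMap ∘ₗ LinearMap.inl ℝ _ _ ∘ₗ M.mulVecLin
  let v : (Fin I → ℝ) →ₗ[ℝ] Fin d → ℝ :=
    LinearMap.pi fun k => (ℓ k).toLinearMap ∘ₗ LinearMap.inr ℝ _ _
  refine ⟨d, LinearMap.toMatrix' w, LinearMap.toMatrix' v, A, b, h₀, ?_⟩
  intro x hx s hs1 hstep h hh0 hh i hi1 hiN
  have hsS : ∀ i, 1 ≤ i → i ≤ N → s i ∈ S := by
    intro i hi
    induction i, hi using Nat.le_induction with
    | base => exact fun _ => hs1 ▸ hs₁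
    | succ i hi ih =>
      intro hiN
      rw [hstep i hi]
      exact hg_inv _ (ih (by omega)) _ (hx i hi (by omega))
  let r : ℕ → Fin J → ℝ := fun i => M.mulVec (h (i - 1))
  have hlayer : ∀ i, 1 ≤ i → h i = fun k => sigmoid (ℓ k (r i, x i) + b k) := by
    intro i hi
    rw [hh i hi]
    funext k
    have hsplit : ((r i, x i) : (Fin J → ℝ) × (Fin I → ℝ)) = (r i, 0) + (0, x i) := by simp
    rw [hsplit, map_add, LinearMap.toMatrix'_mulVec, LinearMap.toMatrix'_mulVec]
    rfl
  have hclose : ∀ i, 1 ≤ i → i ≤ N → ‖r i - s i‖ < min δ 1 := by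
    refine hpert x s r hx hsS hstep (by simp [r, hh0, hM, hs1]) fun i hi hiN hri => ?_
    have hb := (happrox (r i, x i) ⟨hri, hx i hi hiN⟩).1
    rw [← hlayer i hi] at hb
    exact hb.trans_le (min_le_left _ _)
  have hri := hclose i hi1 hiN
  have hsi := hsS i hi1 hiN
  have hrC : r i ∈ cthickening 1 S := mem_cthickening_of_dist_le _ _ _ _ hsi
    (by rw [dist_eq_norm]; exact (hri.trans_le (min_le_right _ _)).le)
  have hout := (happrox (r i, x i) ⟨hrC, hx i hi1 hiN⟩).2.trans_le (min_le_right _ _)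
  rw [← hlayer i hi1] at hout
  have hνi := hνδ (s i) (self_subset_cthickening S hsi) (r i) hrC
    (by rw [dist_comm, dist_eq_norm]; exact hri.trans_le (min_le_left _ _))
  rw [dist_eq_norm] at hνi
  dsimp only at hout
  linarith [norm_sub_le_norm_sub_add_norm_sub (ν (s i)) (ν (r i)) (A.mulVec (h i))]
end
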